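/- Let V be a finite-dimensional complex vector space admitting an additive, conjugate-linear map J : V → V (i.e. J(c • v) = conj(c) • J(v) for all c ∈ ℂ, v ∈ V) with J ∘ J = −id. Then the complex dimension of V is even. -/

import Mathlib

open scoped ComplexConjugate

/-- A complex square matrix `A` with `A * conj A = -1` has even size: taking determinants,
`(-1) ^ n = |det A| ^ 2` is nonnegative. -/
theorem Matrix.even_card_of_mul_map_conj_eq_neg_one {n : Type*} [Fintype n] [DecidableEq n]
    (A : Matrix n n ℂ) (hA : A * A.map (starRingEnd ℂ) = -1) : Even (Fintype.card n) := by
  have hdet : A.det * conj A.det = (-1) ^ Fintype.card n := by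
    rw [RingHom.map_det, RingHom.mapMatrix_apply, ← Matrix.det_mul, hA, Matrix.det_neg,
      Matrix.det_one, mul_one]
  by_contra hodd
  rw [Nat.not_even_iff_odd] at hodd
  rw [hodd.neg_one_pow, Complex.mul_conj] at hdet
  have hnorm : Complex.normSq A.det = -1 := by exact_mod_cast hdet
  linarith [Complex.normSq_nonneg A.det]

/-- If a finite-dimensional complex vector space `V` admits an additive,
conjugate-linear map `J` with `J ∘ J = −id`, then `dim_ℂ V` is even. -/
theorem even_finrank_of_conjLinear_anti_involution
    (V : Type*) [AddCommGroup V] [Module ℂ V] [FiniteDimensional ℂ V]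
    (J : V → V)
    (hadd : ∀ x y, J (x + y) = J x + J y)
    (hconj : ∀ (c : ℂ) (v : V), J (c • v) = (conj c) • J v)
    (hJJ : ∀ v, J (J v) = -v) :
    Even (Module.finrank ℂ V) := by
  let L : V →ₛₗ[starRingEnd ℂ] V := { toFun := J, map_add' := hadd, map_smul' := hconj }
  have hLL : ∀ v, L (L v) = -v := hJJ
  let b := Module.finBasis ℂ V
  rw [← Fintype.card_fin (Module.finrank ℂ V)]
  apply Matrix.even_card_of_mul_map_conj_eq_neg_one (Matrix.of fun i j => b.repr (L (b j)) i)
  ext k j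
  have hsum : L (L (b j)) = ∑ i, conj (b.repr (L (b j)) i) • L (b i) := by
    conv_lhs => rw [← b.sum_repr (L (b j))]
    simp only [map_sum, map_smulₛₗ]
  have hcoord := congrArg (fun v => b.repr v k) hsum
  simp only [hLL, map_neg, map_sum, map_smul, Finsupp.coe_neg, Pi.neg_apply,
    Finsupp.coe_finsetSum, Finset.sum_apply, Finsupp.smul_apply, smul_eq_mul,
    Module.Basis.repr_self, Finsupp.single_apply] at hcoord
  simp only [Matrix.mul_apply, Matrix.map_apply, Matrix.of_apply, Matrix.neg_apply,
    Matrix.one_apply, eq_comm (a := k), hcoord, mul_comm]
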